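/- Let G be a finite group and consider density matrices ρ on ℂ^G, i.e. positive semidefinite complex matrices indexed by G × G with trace 1, that are invariant under both the left and the right regular translation actions: ρ(k g, k h) = ρ(g, h) and ρ(g k, h k) = ρ(g, h) for all g, h, k ∈ G. Then ρ is an extreme point of this convex set of bi-invariant density matrices if and only if there exists an irreducible complex character χ of G such that ρ(g, h) = χ(g h⁻¹) / (|G| · χ(1)) for all g, h ∈ G. -/

import Mathlib

open scoped ComplexOrder
open CategoryTheory
open scoped Matrix

namespace Matrix

variable {n : Type*} [Fintype n]

open scoped MatrixOrder Matrix.Norms.L2Operator in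
theorem PosSemidef.exists_eq_conjTranspose_mul_self {A : Matrix n n ℂ} (hA : A.PosSemidef) :
    ∃ B : Matrix n n ℂ, A = Bᴴ * B := by
  classical
  exact CStarAlgebra.nonneg_iff_eq_star_mul_self.mp hA.nonneg

variable {G : Type*} [Group G] [Fintype G]

/-- The Gram matrix of a finite-dimensional representation is positive semidefinite. -/
theorem posSemidef_of_trace_mul_inv [DecidableEq n] (A : G →* Matrix n n ℂ) :
    (of fun g h => (A (g * h⁻¹)).trace : Matrix G G ℂ).PosSemidef := by
  set H : Matrix n n ℂ := ∑ x, (A x)ᴴ * A x with hH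
  have hpos : H.PosDef := by
    classical
    have h1 : H = 1 + ∑ x ∈ Finset.univ.erase 1, (A x)ᴴ * A x := by
      rw [hH, ← Finset.add_sum_erase _ _ (Finset.mem_univ (1 : G))]
      simp
    rw [h1]
    exact PosDef.one.add_posSemidef
      (posSemidef_sum _ fun x _ => posSemidef_conjTranspose_mul_self (A x))
  have hinv (h : G) : (A h)ᴴ * H * A h = H := by
    simp only [hH, Finset.mul_sum, Finset.sum_mul]
    refine Fintype.sum_equiv (Equiv.mulRight h) _ _ fun x => ?_
    simp [conjTranspose_mul, Matrix.mul_assoc]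
  have hAinv (h : G) : A h⁻¹ = H⁻¹ * (A h)ᴴ * H := by
    have hdet := (isUnit_iff_isUnit_det H).mp hpos.isUnit
    have h1 : A h * A h⁻¹ = 1 := by rw [← map_mul]; simp
    calc A h⁻¹ = H⁻¹ * ((A h)ᴴ * H * A h) * A h⁻¹ := by
          rw [hinv, nonsing_inv_mul _ hdet, Matrix.one_mul]
      _ = H⁻¹ * (A h)ᴴ * H * (A h * A h⁻¹) := by simp only [Matrix.mul_assoc]
      _ = _ := by rw [h1, Matrix.mul_one]
  obtain ⟨B, hB⟩ := hpos.posSemidef.exists_eq_conjTranspose_mul_self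
  obtain ⟨D, hD⟩ := hpos.inv.posSemidef.exists_eq_conjTranspose_mul_self
  let Y : Matrix G (n × n) ℂ := of fun g p => (B * A g * Dᴴ) p.1 p.2
  convert! posSemidef_self_mul_conjTranspose Y using 1
  ext g h
  have h2 : (A (g * h⁻¹)).trace = ((B * A g * Dᴴ) * (B * A h * Dᴴ)ᴴ).trace := by
    rw [map_mul, hAinv, hD]
    conv_lhs => rw [hB]
    rw [show A g * (Dᴴ * D * (A h)ᴴ * (Bᴴ * B)) = (A g * Dᴴ * D * (A h)ᴴ * Bᴴ) * B by
      simp only [Matrix.mul_assoc], trace_mul_comm]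
    simp only [conjTranspose_mul, conjTranspose_conjTranspose, Matrix.mul_assoc]
  simp only [of_apply]
  rw [h2]
  rw [Matrix.mul_apply, Fintype.sum_prod_type]
  rfl

/-- A trace-one positive semidefinite matrix which is proportional to its square is proportional to
its square with a positive constant. -/
theorem PosSemidef.exists_pos_mul_self_eq {P : Matrix n n ℂ} (hP : P.PosSemidef)
    (htr : P.trace = 1) {s : ℂ} (hs : P * P = s • P) : ∃ t : ℝ, 0 < t ∧ s = t := by
  have h1 : (Pᴴ * P).trace = s := by rw [hP.isHermitian.eq, hs, trace_smul, htr]; simp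
  have h2 : 0 ≤ s := h1 ▸ (posSemidef_conjTranspose_mul_self P).trace_nonneg
  have h3 : s ≠ 0 := by
    rintro rfl
    rw [trace_conjTranspose_mul_self_eq_zero_iff] at h1
    simp [h1] at htr
  refine ⟨s.re, (Complex.pos_iff.mp (h2.lt_of_ne' h3)).1, ?_⟩
  exact (Complex.eq_re_of_ofReal_le h2)

theorem PosSemidef.eq_zero_of_smul_add_smul_eq_zero {X Y : Matrix n n ℂ} (hX : X.PosSemidef)
    (hY : Y.PosSemidef) {a b : ℝ} (ha : 0 < a) (hb : 0 < b) (h : a • X + b • Y = 0) : X = 0 := by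
  have h1 := congrArg trace h
  rw [trace_add, trace_smul, trace_smul, trace_zero] at h1
  have h2 := (add_eq_zero_iff_of_nonneg (smul_nonneg ha.le hX.trace_nonneg)
    (smul_nonneg hb.le hY.trace_nonneg)).mp h1
  exact hX.trace_eq_zero_iff.mp ((smul_eq_zero.mp h2.1).resolve_left ha.ne')

/-- Compressing `A` to the kernel of a multiple of a projection `P` with `A * P = s • P`. -/
theorem IsHermitian.compress_eq_sub [DecidableEq n] {A P : Matrix n n ℂ} (hA : A.IsHermitian)
    (hP : P.IsHermitian) {t : ℝ} (ht : 0 < t) (hPP : P * P = (t : ℂ) • P) {s : ℂ}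
    (hAP : A * P = s • P) :
    (1 - (t : ℂ)⁻¹ • P)ᴴ * A * (1 - (t : ℂ)⁻¹ • P) = A - (star s / t) • P := by
  have ht' : (t : ℂ) ≠ 0 := by exact_mod_cast ht.ne'
  have hPA : P * A = star s • P := by
    have := congrArg Matrix.conjTranspose hAP
    rwa [conjTranspose_mul, hA.eq, hP.eq, conjTranspose_smul, hP.eq] at this
  have hH : (1 - (t : ℂ)⁻¹ • P)ᴴ = 1 - (t : ℂ)⁻¹ • P := by
    simp [conjTranspose_sub, hP.eq]
  rw [hH, Matrix.mul_assoc, Matrix.mul_sub, Matrix.mul_one, Matrix.mul_smul, hAP]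
  simp only [Matrix.sub_mul, Matrix.mul_sub, Matrix.one_mul, Matrix.smul_mul, Matrix.mul_smul, hPA,
    hPP, smul_smul]
  match_scalars <;> field_simp
  ring

end Matrix

/-- A matrix over a group invariant under simultaneous left and right translations. -/
structure IsBiinvariant {G : Type*} [Group G] (ρ : Matrix G G ℂ) : Prop where
  left (g h k : G) : ρ (k * g) (k * h) = ρ g h
  right (g h k : G) : ρ (g * k) (h * k) = ρ g h

namespace FDRep

theorem char_one_ne_zero {G : Type} [Group G] (V : FDRep ℂ G) [Simple V] : V.character 1 ≠ 0 := by
  rw [char_one]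
  intro h
  have := Module.finrank_zero_iff.mp (Nat.cast_eq_zero.mp h)
  apply id_nonzero V
  ext x
  exact Subsingleton.elim (α := V) _ _

/-- Schur's lemma: an endomorphism commuting with a simple representation is a scalar. -/
theorem eq_smul_one_of_commute {G : Type} [Group G] (V : FDRep ℂ G) [Simple V]
    (T : V →ₗ[ℂ] V) (hT : ∀ g, Commute (V.ρ g) T) :
    ∃ s : ℂ, T = s • 1 := by
  have mem (S : V →ₗ[ℂ] V) (hS : ∀ g, Commute (V.ρ g) S) :
      S ∈ (Representation.linHom V.ρ V.ρ).invariants := fun g => by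
    change V.ρ g * (S * V.ρ g⁻¹) = S
    rw [← mul_assoc, (hS g).eq, mul_assoc, ← map_mul]
    simp
  have hr : Module.finrank ℂ (Representation.linHom V.ρ V.ρ).invariants = 1 := by
    rw [(Representation.linHom.invariantsEquivFDRepHom V V).finrank_eq]
    exact finrank_endomorphism_simple_eq_one ℂ V
  have h1 : (⟨1, mem 1 fun g => Commute.one_right _⟩ :
      (Representation.linHom V.ρ V.ρ).invariants) ≠ 0 := fun h => by
    have h2 : (1 : V →ₗ[ℂ] V) = 0 := congrArg Subtype.val h
    apply V.char_one_ne_zero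
    rw [character, map_one, h2, map_zero]
  obtain ⟨s, hs⟩ := (finrank_eq_one_iff_of_nonzero' _ h1).mp hr ⟨T, mem T hT⟩
  exact ⟨s, (congrArg Subtype.val hs).symm⟩

variable {G : Type} [Group G] [Fintype G] (V : FDRep ℂ G)

/-- The density matrix attached to the character of a representation. -/
noncomputable def charMatrix : Matrix G G ℂ :=
  .of fun g h => V.character (g * h⁻¹) / ((Fintype.card G : ℂ) * V.character 1)

theorem isBiinvariant_charMatrix : IsBiinvariant V.charMatrix where
  left g h k := by
    have := V.char_conj (g * h⁻¹) k
    simp only [mul_assoc] at this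
    simp [charMatrix, this, mul_assoc]
  right g h k := by simp [charMatrix, mul_assoc]

theorem posSemidef_charMatrix : V.charMatrix.PosSemidef := by
  classical
  let b := Module.finBasis ℂ V
  have h := Matrix.posSemidef_of_trace_mul_inv (n := Fin (Module.finrank ℂ V))
    ((LinearMap.toMatrixAlgEquiv b : _ →* _).comp V.ρ)
  have hc : (0 : ℂ) ≤ ((Fintype.card G : ℂ) * V.character 1)⁻¹ := by
    rw [char_one]
    norm_cast
    positivity
  convert! h.smul hc using 1
  ext g h
  simp [charMatrix, character, div_eq_inv_mul, LinearMap.trace_eq_matrix_trace ℂ b,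
    LinearMap.toMatrixAlgEquiv]

theorem trace_charMatrix [Simple V] : V.charMatrix.trace = 1 := by
  have := V.char_one_ne_zero
  simp only [Matrix.trace, Matrix.diag_apply, charMatrix, Matrix.of_apply, mul_inv_cancel,
    Finset.sum_const, Finset.card_univ, nsmul_eq_mul]
  field_simp

variable {ρ : Matrix G G ℂ}

theorem mul_charMatrix_of_sum_eq (hρ : IsBiinvariant ρ) {s : ℂ}
    (hs : ∑ x, ρ 1 x • V.ρ x = s • 1) : ρ * V.charMatrix = s • V.charMatrix := by
  ext g h
  have h1 : ∑ x, ρ 1 x * V.character (x * (g * h⁻¹)) = s * V.character (g * h⁻¹) := by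
    have := congrArg (fun T => LinearMap.trace ℂ V (T * V.ρ (g * h⁻¹))) hs
    simpa [Finset.sum_mul, character] using this
  rw [Matrix.mul_apply, Matrix.smul_apply, smul_eq_mul, ← Equiv.sum_comp (Equiv.mulRight g)]
  have h2 (x : G) : ρ g (x * g) = ρ 1 x := by simpa using hρ.right 1 x g
  simp only [charMatrix, Matrix.of_apply, Equiv.coe_mulRight, h2, mul_assoc, mul_div_assoc',
    ← Finset.sum_div, h1]

theorem exists_mul_charMatrix_eq_smul [Simple V] (hρ : IsBiinvariant ρ) :
    ∃ s : ℂ, ρ * V.charMatrix = s • V.charMatrix := by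
  obtain ⟨s, hs⟩ := V.eq_smul_one_of_commute (∑ x, ρ 1 x • V.ρ x) fun g => by
    rw [Commute, SemiconjBy, Finset.mul_sum, Finset.sum_mul]
    refine Fintype.sum_equiv (MulAut.conj g).toEquiv _ _ fun x => ?_
    have h2 : ρ 1 (g * x * g⁻¹) = ρ 1 x := by
      have h3 := hρ.right g (g * x) g⁻¹
      have h4 := hρ.left 1 x g
      rw [mul_one] at h4
      rw [← h4, ← h3, mul_inv_cancel]
    simp [h2, ← map_mul]
  exact ⟨s, V.mul_charMatrix_of_sum_eq hρ hs⟩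

end FDRep

namespace Representation

variable {k G V : Type*} [Field k] [AddCommGroup V] [Module k V] [FiniteDimensional k V]

theorem exists_le_isIrreducible [Monoid G] {ρ : Representation k G V} {W : Subrepresentation ρ}
    (hW : W ≠ ⊥) : ∃ S ≤ W, S.toRepresentation.IsIrreducible := by
  have hmono : StrictMono (Subrepresentation.toSubmodule (ρ := ρ)) := fun _ _ h => h
  have : WellFoundedLT (Subrepresentation ρ) := hmono.wellFoundedLT
  have : IsAtomic (Subrepresentation ρ) := isAtomic_of_orderBot_wellFounded_lt wellFounded_lt
  obtain ⟨S, hS, hSW⟩ := (eq_bot_or_exists_atom_le W).resolve_left hW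
  refine ⟨S, hSW, ?_⟩
  let φ (T : Subrepresentation S.toRepresentation) : Subrepresentation ρ :=
    ⟨T.toSubmodule.map S.toSubmodule.subtype, by
      rintro g _ ⟨v, hv, rfl⟩
      exact ⟨_, T.apply_mem_toSubmodule g hv, rfl⟩⟩
  have hφ (T) : φ T ≤ S := by
    rintro _ ⟨v, -, rfl⟩
    exact v.2
  have hinj : Function.Injective φ := fun T T' h =>
    Subrepresentation.toSubmodule_injective <|
      Submodule.map_injective_of_injective S.toSubmodule.injective_subtype
        (congrArg Subrepresentation.toSubmodule h)
  have hbot : φ ⊥ = ⊥ := Subrepresentation.toSubmodule_injective (Submodule.map_bot _)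
  have htop : φ ⊤ = S := Subrepresentation.toSubmodule_injective (Submodule.map_subtype_top _)
  have : Nontrivial (Subrepresentation S.toRepresentation) :=
    ⟨⊥, ⊤, fun h => hS.1 (by rw [← htop, ← h, hbot])⟩
  exact ⟨fun T => ((hS.le_iff).mp (hφ T)).imp (fun h => hinj (h.trans hbot.symm))
    fun h => hinj (h.trans htop.symm)⟩

theorem simple_of_isIrreducible {G V : Type} [Group G] [Fintype G] [AddCommGroup V] [Module ℂ V]
    [FiniteDimensional ℂ V] (ρ : Representation ℂ G V) [ρ.IsIrreducible] :
    Simple (FDRep.of ρ) := by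
  have : Invertible (Nat.card G : ℂ) := invertibleOfNonzero (by simp)
  rw [FDRep.simple_iff_char_is_norm_one]
  have h := char_orthonormal ρ ρ
  rw [if_pos ⟨.refl _⟩, inv_mul_eq_one₀ (by simp)] at h
  exact h.symm

end Representation

/-- The right regular representation on functions. -/
def rightRegular (G : Type*) [Group G] : Representation ℂ G (G → ℂ) where
  toFun k := LinearMap.funLeft ℂ ℂ (· * k)
  map_one' := by ext; simp [LinearMap.funLeft]
  map_mul' k l := by
    ext
    simp [LinearMap.funLeft, mul_assoc]

namespace IsBiinvariant

theorem sum_smul_rightRegular {G : Type*} [Group G] [Fintype G] {ρ : Matrix G G ℂ}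
    (hρ : IsBiinvariant ρ) : ∑ x, ρ 1 x • rightRegular G x = ρ.mulVecLin := by
  refine LinearMap.ext fun v => funext fun g => ?_
  rw [Matrix.mulVecLin_apply, Matrix.mulVec, dotProduct,
    ← Equiv.sum_comp (Equiv.mulLeft g) fun x => ρ g x * v x]
  have h (x : G) : ρ g (g * x) = ρ 1 x := by simpa using hρ.left 1 x g
  simp [h, rightRegular, LinearMap.funLeft]

theorem mulVec_rightRegular {G : Type*} [Group G] [Fintype G] {ρ : Matrix G G ℂ}
    (hρ : IsBiinvariant ρ) (k : G) (v : G → ℂ) :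
    ρ.mulVec (rightRegular G k v) = rightRegular G k (ρ.mulVec v) := by
  ext g
  change ∑ x, ρ g x * v (x * k) = ∑ x, ρ (g * k) x * v x
  rw [← Equiv.sum_comp (Equiv.mulRight k) fun x => ρ (g * k) x * v x]
  simp [hρ.right]

variable {G : Type} [Group G] [Fintype G] {ρ : Matrix G G ℂ}

/-- Every eigenvalue of a biinvariant matrix is attained on the matrix of some simple character. -/
theorem exists_simple_mul_charMatrix_eq (hρ : IsBiinvariant ρ) {s : ℂ} {v : G → ℂ} (hv : v ≠ 0)
    (hs : ρ.mulVec v = s • v) :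
    ∃ V : FDRep ℂ G, Simple V ∧ ρ * V.charMatrix = s • V.charMatrix := by
  let W : Subrepresentation (rightRegular G) :=
    ⟨Module.End.eigenspace ρ.mulVecLin s, fun k w hw => by
      rw [Module.End.mem_eigenspace_iff, Matrix.mulVecLin_apply] at hw ⊢
      rw [hρ.mulVec_rightRegular, hw, map_smul]⟩
  have hW : W ≠ ⊥ := fun h => by
    have h1 : v ∈ W.toSubmodule := Module.End.mem_eigenspace_iff.mpr hs
    rw [h] at h1
    exact hv ((Submodule.mem_bot ℂ).mp h1)
  obtain ⟨S, hSW, hS⟩ := Representation.exists_le_isIrreducible hW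
  refine ⟨FDRep.of S.toRepresentation, Representation.simple_of_isIrreducible _,
    FDRep.mul_charMatrix_of_sum_eq _ hρ ?_⟩
  rw [FDRep.of_ρ']
  refine LinearMap.ext fun w => Subtype.ext ?_
  have h1 : ρ.mulVecLin w = s • (w : G → ℂ) := Module.End.mem_eigenspace_iff.mp (hSW w.2)
  rw [← hρ.sum_smul_rightRegular] at h1
  simpa [Subrepresentation.toRepresentation] using h1

end IsBiinvariant

theorem Matrix.PosSemidef.exists_pos_eigenvalue {n : Type*} [Fintype n] {A : Matrix n n ℂ}
    (hA : A.PosSemidef) (hA0 : A ≠ 0) :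
    ∃ (l : ℝ) (v : n → ℂ), 0 < l ∧ v ≠ 0 ∧ A.mulVec v = (l : ℂ) • v := by
  classical
  obtain ⟨i, hi⟩ := Function.ne_iff.mp (mt hA.isHermitian.eigenvalues_eq_zero_iff.mp hA0)
  refine ⟨_, _, (hA.eigenvalues_nonneg i).lt_of_ne' hi, fun h => ?_,
    hA.isHermitian.mulVec_eigenvectorBasis i⟩
  exact hA.isHermitian.eigenvectorBasis.orthonormal.ne_zero i (by ext j; exact congrFun h j)

namespace FDRep

variable {G : Type} [Group G] [Fintype G] (V : FDRep ℂ G)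

theorem exists_pos_charMatrix_mul_self [Simple V] :
    ∃ t : ℝ, 0 < t ∧ V.charMatrix * V.charMatrix = (t : ℂ) • V.charMatrix := by
  obtain ⟨s, hs⟩ := V.exists_mul_charMatrix_eq_smul V.isBiinvariant_charMatrix
  obtain ⟨t, ht, rfl⟩ := V.posSemidef_charMatrix.exists_pos_mul_self_eq V.trace_charMatrix hs
  exact ⟨t, ht, hs⟩

end FDRep

/-- The convex set of biinvariant density matrices. -/
def biinvariantDensity (G : Type*) [Group G] [Fintype G] : Set (Matrix G G ℂ) :=
  {ρ | ρ.PosSemidef ∧ ρ.trace = 1 ∧ IsBiinvariant ρ}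

section

variable {G : Type} [Group G] [Fintype G]

theorem charMatrix_mem_extremePoints (V : FDRep ℂ G) [Simple V] :
    V.charMatrix ∈ Set.extremePoints ℝ (biinvariantDensity G) := by
  classical
  set P := V.charMatrix
  have hP : P.PosSemidef := V.posSemidef_charMatrix
  refine ⟨⟨hP, V.trace_charMatrix, V.isBiinvariant_charMatrix⟩, ?_⟩
  rintro σ ⟨hσ, hσ1, hσinv⟩ τ ⟨hτ, -, -⟩ ⟨a, b, ha, hb, -, hab⟩
  obtain ⟨t, ht, hPP⟩ := V.exists_pos_charMatrix_mul_self
  obtain ⟨s, hs⟩ := V.exists_mul_charMatrix_eq_smul hσinv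
  have hC := hP.isHermitian.compress_eq_sub hP.isHermitian ht hPP hPP
  have hCσ := hσ.isHermitian.compress_eq_sub hP.isHermitian ht hPP hs
  set C := 1 - (t : ℂ)⁻¹ • P
  have ht' : (t : ℂ) ≠ 0 := by exact_mod_cast ht.ne'
  have h0 : a • (Cᴴ * σ * C) + b • (Cᴴ * τ * C) = 0 := by
    have h1 : Cᴴ * (a • σ + b • τ) * C = 0 := by
      rw [hab, hC]
      simp [ht']
    simpa [Matrix.mul_add, Matrix.add_mul] using h1
  have h1 := (hσ.conjTranspose_mul_mul_same C).eq_zero_of_smul_add_smul_eq_zero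
    (hτ.conjTranspose_mul_mul_same C) ha hb h0
  rw [hCσ, sub_eq_zero] at h1
  have h2 := congrArg Matrix.trace h1
  rw [hσ1, Matrix.trace_smul, V.trace_charMatrix, smul_eq_mul, mul_one] at h2
  rw [h1, ← h2, one_smul]

theorem exists_eq_charMatrix_of_mem_extremePoints {ρ : Matrix G G ℂ}
    (h : ρ ∈ Set.extremePoints ℝ (biinvariantDensity G)) :
    ∃ V : FDRep ℂ G, Simple V ∧ ρ = V.charMatrix := by
  classical
  obtain ⟨⟨hρ, hρ1, hρinv⟩, hext⟩ := h
  have hρ0 : ρ ≠ 0 := by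
    rintro rfl
    simp at hρ1
  obtain ⟨l, v, hl, hv, hlv⟩ := hρ.exists_pos_eigenvalue hρ0
  obtain ⟨V, hV, hlV⟩ := hρinv.exists_simple_mul_charMatrix_eq hv hlv
  refine ⟨V, hV, ?_⟩
  obtain ⟨t, ht, hPP⟩ := V.exists_pos_charMatrix_mul_self
  have hP1 := V.trace_charMatrix
  have hPinv := V.isBiinvariant_charMatrix
  have hP := V.posSemidef_charMatrix
  set P := V.charMatrix
  have hc : 0 < l / t := div_pos hl ht
  have hrest : (ρ - (l / t) • P).PosSemidef := by
    have h1 := hρ.conjTranspose_mul_mul_same (1 - (t : ℂ)⁻¹ • P)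
    rw [hρ.isHermitian.compress_eq_sub hP.isHermitian ht hPP hlV] at h1
    convert! h1 using 2
    ext
    simp
  set c := l / t
  have htr : (ρ - c • P).trace = ((1 - c : ℝ) : ℂ) := by
    simp [Matrix.trace_sub, Matrix.trace_smul, hρ1, hP1]
  have hc1 : 0 ≤ 1 - c := by
    have h1 := hrest.trace_nonneg
    rw [htr] at h1
    exact_mod_cast h1
  rcases hc1.eq_or_lt with h0 | h0
  · rw [← h0, Complex.ofReal_zero, hrest.trace_eq_zero_iff, sub_eq_zero] at htr
    rw [htr, ← sub_eq_zero.mp h0.symm, one_smul]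
  · refine (hext (x₁ := P) ⟨hP, hP1, hPinv⟩ (x₂ := (1 - c)⁻¹ • (ρ - c • P)) ⟨?_, ?_, ?_, ?_⟩
      ⟨c, 1 - c, hc, h0, by ring, ?_⟩).symm
    · exact hrest.smul (inv_nonneg.mpr hc1)
    · rw [Matrix.trace_smul, htr, Complex.real_smul, ← Complex.ofReal_mul, inv_mul_cancel₀ h0.ne',
        Complex.ofReal_one]
    · intro g h k
      simp [hρinv.left, hPinv.left]
    · intro g h k
      simp [hρinv.right, hPinv.right]
    · rw [smul_inv_smul₀ h0.ne', add_sub_cancel]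

end

theorem stmt3 (G : Type) [Group G] [Fintype G]
    (K : Set (Matrix G G ℂ))
    (hK : K = {ρ | ρ.PosSemidef ∧ ρ.trace = 1 ∧
      (∀ g h k : G, ρ (k * g) (k * h) = ρ g h) ∧
      (∀ g h k : G, ρ (g * k) (h * k) = ρ g h)})
    (ρ : Matrix G G ℂ) :
    ρ ∈ Set.extremePoints ℝ K ↔
      ∃ V : FDRep ℂ G, Simple V ∧
        ∀ g h : G, ρ g h = V.character (g * h⁻¹) / ((Fintype.card G : ℂ) * V.character 1) := by
  have hK' : K = biinvariantDensity G := by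
    rw [hK]
    ext σ
    exact and_congr_right fun _ => and_congr_right fun _ =>
      ⟨fun h => ⟨h.1, h.2⟩, fun h => ⟨h.left, h.right⟩⟩
  rw [hK']
  constructor
  · intro h
    obtain ⟨V, hV, rfl⟩ := exists_eq_charMatrix_of_mem_extremePoints h
    exact ⟨V, hV, fun _ _ => rfl⟩
  · rintro ⟨V, hV, h⟩
    obtain rfl : ρ = V.charMatrix := by
      ext g k
      exact h g k
    exact charMatrix_mem_extremePoints V
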